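/- Let the stationary setup hold with additionally E[X₀⁴] < ∞. Define G_n = σ(X_k : k ≥ n) for n ≥ 1 and the strong mixing coefficients α_n = sup{ |P(A ∩ B) − P(A)P(B)| : A ∈ F₀, B ∈ G_n }. Then for every n ≥ 1, ‖E(S_n | F₀)‖ ≤ 8 ‖X₀‖₄ ∑_{k=1}^n α_k^{1/4}, where ‖X₀‖₄ = (E[X₀⁴])^{1/4}. -/

import Mathlib

open MeasureTheory

/-- The centered conditional expectation attains its `L¹` norm, up to a factor two, on a single
event of the conditioning σ-algebra. -/
theorem exists_integral_abs_condExp_sub_eq {Ω : Type*} {m m0 : MeasurableSpace Ω}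
    {P : Measure Ω} [IsProbabilityMeasure P] (hm : m ≤ m0) {f : Ω → ℝ} (hf : Integrable f P) :
    ∃ A, MeasurableSet[m] A ∧
      ∫ ω, |(P[f|m]) ω - ∫ x, f x ∂P| ∂P = 2 * (∫ ω in A, f ω ∂P - P.real A * ∫ x, f x ∂P) := by
  set c := ∫ x, f x ∂P
  have hA : MeasurableSet[m] {ω | c ≤ (P[f|m]) ω} :=
    @measurableSet_le _ _ _ _ _ m _ _ _ _ _ measurable_const
      stronglyMeasurable_condExp.measurable
  refine ⟨_, hA, ?_⟩
  set A := {ω | c ≤ (P[f|m]) ω}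
  have hV : Integrable (fun ω => (P[f|m]) ω - c) P := integrable_condExp.sub (integrable_const c)
  have hV0 : ∫ ω, ((P[f|m]) ω - c) ∂P = 0 := by
    rw [integral_sub integrable_condExp (integrable_const c), integral_condExp hm]
    simp [c]
  have hVA : ∫ ω in A, ((P[f|m]) ω - c) ∂P = ∫ ω in A, f ω ∂P - P.real A * c := by
    rw [integral_sub integrable_condExp.integrableOn (integrable_const c).integrableOn,
      setIntegral_condExp hm hf hA]
    simp
  have habs : (fun ω => |(P[f|m]) ω - c|)
      = fun ω => 2 * A.indicator (fun ω => (P[f|m]) ω - c) ω - ((P[f|m]) ω - c) := by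
    ext ω
    by_cases h : ω ∈ A
    · have : c ≤ (P[f|m]) ω := h
      rw [Set.indicator_of_mem h, abs_of_nonneg (by linarith)]
      ring
    · have : (P[f|m]) ω < c := not_le.mp h
      rw [Set.indicator_of_notMem h, abs_of_nonpos (by linarith)]
      ring
  rw [habs, integral_sub ((hV.indicator (hm _ hA)).const_mul 2) hV, integral_const_mul,
    integral_indicator (hm _ hA), hV0, hVA, sub_zero]

/-- The covariance inequality for a bounded variable, in conditional form. -/
theorem integral_abs_condExp_sub_le {Ω : Type*} {m₁ m₂ m0 : MeasurableSpace Ω}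
    {P : Measure Ω} [IsProbabilityMeasure P] (hm₁ : m₁ ≤ m0) (hm₂ : m₂ ≤ m0) {a C : ℝ}
    (hα : ∀ A B, MeasurableSet[m₁] A → MeasurableSet[m₂] B →
      |P.real (A ∩ B) - P.real A * P.real B| ≤ a)
    {f : Ω → ℝ} (hf : StronglyMeasurable[m₂] f) (hfC : ∀ ω, |f ω| ≤ C) :
    ∫ ω, |(P[f|m₁]) ω - ∫ x, f x ∂P| ∂P ≤ 4 * C * a := by
  have hC : 0 ≤ C := by
    obtain ⟨ω⟩ : Nonempty Ω := nonempty_of_isProbabilityMeasure P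
    exact (abs_nonneg _).trans (hfC ω)
  have hfi : Integrable f P :=
    Integrable.of_bound (hf.mono hm₂).aestronglyMeasurable C (.of_forall hfC)
  obtain ⟨A, hA, hAeq⟩ := exists_integral_abs_condExp_sub_eq hm₁ hfi
  have hgi : Integrable (A.indicator fun _ => (1 : ℝ)) P :=
    (integrable_const 1).indicator (hm₁ _ hA)
  have hg : ∫ ω, A.indicator (fun _ => (1 : ℝ)) ω ∂P = P.real A := by
    rw [integral_indicator (hm₁ _ hA)]
    simp
  obtain ⟨B, hB, hBeq⟩ := exists_integral_abs_condExp_sub_eq hm₂ hgi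
  rw [hg] at hBeq
  have hBle : ∫ ω, |(P[A.indicator fun _ => (1 : ℝ)|m₂]) ω - P.real A| ∂P ≤ 2 * a := by
    rw [hBeq, setIntegral_indicator (hm₁ _ hA)]
    have := (le_abs_self _).trans (hα A B hA hB)
    simp only [integral_const, MeasurableSet.univ, measureReal_restrict_apply, Set.univ_inter,
      smul_eq_mul, mul_one]
    rw [Set.inter_comm, mul_comm (P.real B)]
    linarith
  have hpull : ∫ ω in A, f ω ∂P = ∫ ω, f ω * (P[A.indicator fun _ => (1 : ℝ)|m₂]) ω ∂P := by
    have h := integral_congr_ae (condExp_stronglyMeasurable_mul_of_bound hm₂ hf hgi C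
      (.of_forall hfC))
    rw [integral_condExp hm₂] at h
    refine Eq.trans ?_ h
    rw [← integral_indicator (hm₁ _ hA)]
    congr 1
    ext ω
    by_cases h : ω ∈ A <;> simp [h]
  have hfgi : Integrable (fun ω => f ω * (P[A.indicator fun _ => (1 : ℝ)|m₂]) ω) P :=
    integrable_condExp.bdd_mul (hf.mono hm₂).aestronglyMeasurable (.of_forall hfC)
  have hVi : Integrable (fun ω => (P[A.indicator fun _ => (1 : ℝ)|m₂]) ω - P.real A) P :=
    integrable_condExp.sub (integrable_const _)
  have hcov : ∫ ω in A, f ω ∂P - P.real A * ∫ x, f x ∂P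
      = ∫ ω, f ω * ((P[A.indicator fun _ => (1 : ℝ)|m₂]) ω - P.real A) ∂P := by
    rw [hpull, ← integral_const_mul, ← integral_sub hfgi (hfi.const_mul _)]
    congr 1
    ext ω
    ring
  have hle : ∫ ω, f ω * ((P[A.indicator fun _ => (1 : ℝ)|m₂]) ω - P.real A) ∂P
      ≤ ∫ ω, C * |(P[A.indicator fun _ => (1 : ℝ)|m₂]) ω - P.real A| ∂P := by
    refine integral_mono (hVi.bdd_mul (hf.mono hm₂).aestronglyMeasurable (.of_forall hfC))
      (hVi.abs.const_mul C) fun ω => ?_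
    refine (le_abs_self _).trans ?_
    rw [abs_mul]
    exact mul_le_mul_of_nonneg_right (hfC ω) (abs_nonneg _)
  rw [integral_const_mul] at hle
  rw [hAeq, hcov]
  nlinarith [mul_le_mul_of_nonneg_left hBle hC]

theorem integral_condExp_sq_le {Ω : Type*} {m m0 : MeasurableSpace Ω} {P : Measure Ω}
    [IsFiniteMeasure P] (hm : m ≤ m0) {f : Ω → ℝ} (hf : MemLp f 2 P) :
    ∫ ω, (P[f|m]) ω ^ 2 ∂P ≤ ∫ ω, f ω ^ 2 ∂P := by
  rw [← integral_condExp (f := fun ω => f ω ^ 2) hm]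
  have hi := (hf.condExp (m := m) one_le_two).integrable_sq
  refine integral_mono_ae hi integrable_condExp ?_
  have h1 := ProbabilityTheory.condVar_ae_eq_condExp_sq_sub_sq_condExp hm hf
  have h2 : 0 ≤ᵐ[P] ProbabilityTheory.condVar m f P :=
    condExp_nonneg (.of_forall fun ω => sq_nonneg _)
  filter_upwards [h1, h2] with ω h1 h2
  have : (P[f ^ 2|m]) ω - (P[f|m]) ω ^ 2 = ProbabilityTheory.condVar m f P ω := h1.symm
  have h3 : (0 : ℝ) ≤ ProbabilityTheory.condVar m f P ω := h2
  change (P[f|m]) ω ^ 2 ≤ (P[f ^ 2|m]) ω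
  linarith

theorem integral_condExp_sq_le_of_truncation {Ω : Type*} {m₁ m₂ m0 : MeasurableSpace Ω}
    {P : Measure Ω} [IsProbabilityMeasure P] (hm₁ : m₁ ≤ m0) (hm₂ : m₂ ≤ m0) {a C : ℝ}
    (hC : 0 < C)
    (hα : ∀ A B, MeasurableSet[m₁] A → MeasurableSet[m₂] B →
      |P.real (A ∩ B) - P.real A * P.real B| ≤ a)
    {f : Ω → ℝ} (hf : Measurable[m₂] f) (hf4 : Integrable (fun ω => f ω ^ 4) P)
    (hmean : ∫ ω, f ω ∂P = 0) :
    ∫ ω, (P[f|m₁]) ω ^ 2 ∂P ≤ 16 * C ^ 2 * a + 8 * (∫ ω, f ω ^ 4 ∂P) / C ^ 2 := by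
  have hfm : Measurable f := hf.mono hm₂ le_rfl
  set D := {ω | |f ω| ≤ C}
  have hD : MeasurableSet[m₂] D :=
    @measurableSet_le _ _ _ _ _ m₂ _ _ _ _ _ (continuous_abs.measurable.comp hf) measurable_const
  set g := D.indicator f
  set h := Dᶜ.indicator f
  have hgh : f = g + h := (Set.indicator_self_add_compl D f).symm
  have hgC : ∀ ω, |g ω| ≤ C := fun ω => by
    by_cases hω : ω ∈ D
    · rw [show g ω = f ω from Set.indicator_of_mem hω f]
      exact hω
    · simpa [g, hω] using hC.le
  have hgm : Measurable[m₂] g := hf.indicator hD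
  have hhm : Measurable h := hfm.indicator (hm₂ _ hD).compl
  have hh : ∀ ω, h ω ^ 2 ≤ f ω ^ 4 / C ^ 2 := fun ω => by
    by_cases hω : ω ∈ D
    · rw [show h ω = 0 from Set.indicator_of_notMem (Set.notMem_compl_iff.mpr hω) f]
      simp only [ne_eq, OfNat.ofNat_ne_zero, not_false_eq_true, zero_pow]
      positivity
    · have hω' : C < |f ω| := not_le.mp hω
      have : C ^ 2 ≤ f ω ^ 2 := by rw [← sq_abs (f ω)]; gcongr
      rw [show h ω = f ω by simp [h, hω], le_div_iff₀ (by positivity)]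
      nlinarith [sq_nonneg (f ω)]
  have hh2i : Integrable (fun ω => h ω ^ 2) P :=
    (hf4.div_const (C ^ 2)).mono' (hhm.pow_const 2).aestronglyMeasurable
      (.of_forall fun ω => by
        rw [Real.norm_eq_abs, abs_of_nonneg (sq_nonneg _)]
        exact hh ω)
  have hhL : MemLp h 2 P := (memLp_two_iff_integrable_sq hhm.aestronglyMeasurable).mpr hh2i
  have hh2 : ∫ ω, h ω ^ 2 ∂P ≤ (∫ ω, f ω ^ 4 ∂P) / C ^ 2 := by
    rw [← integral_div]
    exact integral_mono hh2i (hf4.div_const _) hh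
  have hhi : Integrable h P := hhL.integrable one_le_two
  have hgi : Integrable g P :=
    Integrable.of_bound (hgm.mono hm₂ le_rfl).aestronglyMeasurable C (.of_forall hgC)
  have hsum : ∫ ω, g ω ∂P + ∫ ω, h ω ∂P = 0 := by
    rw [← integral_add hgi hhi, ← hmean]
    exact integral_congr_ae (.of_forall fun ω => (congrFun hgh ω).symm)
  set c := ∫ ω, g ω ∂P
  have hc : |c| ≤ C := by
    simpa using norm_integral_le_of_norm_le_const (μ := P) (f := g) (C := C) (.of_forall hgC)
  have hsq : (∫ ω, h ω ∂P) ^ 2 ≤ ∫ ω, h ω ^ 2 ∂P := by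
    have := ProbabilityTheory.variance_nonneg h P
    rw [ProbabilityTheory.variance_eq_sub hhL] at this
    have h' : ∫ ω, (h ^ 2) ω ∂P = ∫ ω, h ω ^ 2 ∂P := rfl
    linarith
  have hcond := integral_condExp_sq_le hm₁ hhL
  have hg1 := integral_abs_condExp_sub_le hm₁ hm₂ hα hgm.stronglyMeasurable hgC
  have hbdd : ∀ᵐ ω ∂P, |(P[g|m₁]) ω| ≤ C :=
    ae_bdd_abs_condExp_of_ae_bdd_abs (.of_forall hgC)
  have hWi : Integrable (fun ω => |(P[g|m₁]) ω - c|) P :=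
    (integrable_condExp.sub (integrable_const c)).abs
  have hHi := (hhL.condExp (m := m₁) one_le_two).integrable_sq
  have hpt : ∀ᵐ ω ∂P, (P[f|m₁]) ω ^ 2 ≤
      4 * C * |(P[g|m₁]) ω - c| + (4 * (P[h|m₁]) ω ^ 2 + 4 * c ^ 2) := by
    rw [hgh]
    filter_upwards [hbdd, condExp_add hgi hhi m₁] with ω hb hadd
    rw [hadd, Pi.add_apply]
    set u := (P[g|m₁]) ω
    set v := (P[h|m₁]) ω
    have hw : |u - c| ≤ 2 * C := (abs_sub _ _).trans (by linarith)
    have : (u - c) ^ 2 ≤ 2 * C * |u - c| := by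
      rw [← sq_abs, sq]
      gcongr
    nlinarith [sq_nonneg ((u - c) - (v + c)), sq_nonneg (v - c)]
  have hRi : Integrable (fun ω => 4 * (P[h|m₁]) ω ^ 2 + 4 * c ^ 2) P :=
    (hHi.const_mul 4).add (integrable_const _)
  have hdom : Integrable (fun ω => 4 * C * |(P[g|m₁]) ω - c| +
      (4 * (P[h|m₁]) ω ^ 2 + 4 * c ^ 2)) P :=
    (hWi.const_mul _).add hRi
  have key := integral_mono_of_nonneg (.of_forall fun ω => sq_nonneg _) hdom hpt
  rw [integral_add (hWi.const_mul _) hRi,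
    integral_add (hHi.const_mul 4) (integrable_const _), integral_const_mul,
    integral_const_mul] at key
  simp only [integral_const, probReal_univ, one_smul] at key
  have hc2 : c ^ 2 = (∫ ω, h ω ∂P) ^ 2 := by
    rw [eq_neg_of_add_eq_zero_left hsum, neg_sq]
  rw [mul_div_assoc]
  nlinarith [mul_le_mul_of_nonneg_left hg1 hC.le]

theorem sqrt_integral_condExp_sq_le {Ω : Type*} {m₁ m₂ m0 : MeasurableSpace Ω}
    {P : Measure Ω} [IsProbabilityMeasure P] (hm₁ : m₁ ≤ m0) (hm₂ : m₂ ≤ m0) {a : ℝ}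
    (ha : 0 ≤ a)
    (hα : ∀ A B, MeasurableSet[m₁] A → MeasurableSet[m₂] B →
      |P.real (A ∩ B) - P.real A * P.real B| ≤ a)
    {f : Ω → ℝ} (hf : Measurable[m₂] f) (hf4 : Integrable (fun ω => f ω ^ 4) P)
    (hmean : ∫ ω, f ω ∂P = 0) :
    √(∫ ω, (P[f|m₁]) ω ^ 2 ∂P) ≤
      8 * (∫ ω, f ω ^ 4 ∂P) ^ ((1 : ℝ) / 4) * a ^ ((1 : ℝ) / 4) := by
  have hM : 0 ≤ ∫ ω, f ω ^ 4 ∂P := integral_nonneg fun ω => by positivity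
  have hpow : ∀ x : ℝ, 0 ≤ x → (x ^ ((1 : ℝ) / 4)) ^ 4 = x := fun x hx => by
    rw [← Real.rpow_natCast, ← Real.rpow_mul hx]
    norm_num
  set M := ∫ ω, f ω ^ 4 ∂P
  set q := M ^ ((1 : ℝ) / 4)
  set b := a ^ ((1 : ℝ) / 4)
  have hq : 0 ≤ q := Real.rpow_nonneg hM _
  have hb : 0 ≤ b := Real.rpow_nonneg ha _
  have hlim : Filter.Tendsto (fun ε : ℝ => 8 * (q + ε) * (b + ε)) (nhdsWithin 0 (Set.Ioi 0))
      (nhds (8 * q * b)) := by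
    have : Continuous fun ε : ℝ => 8 * (q + ε) * (b + ε) := by fun_prop
    simpa using (this.tendsto 0).mono_left nhdsWithin_le_nhds
  refine ge_of_tendsto hlim ?_
  filter_upwards [self_mem_nhdsWithin] with ε hε
  have hε : 0 < ε := hε
  have hMq : M ≤ (q + ε) ^ 4 := by
    rw [← hpow M hM]
    exact pow_le_pow_left₀ hq (by linarith) 4
  have hab : a ≤ (b + ε) ^ 4 := by
    rw [← hpow a ha]
    exact pow_le_pow_left₀ hb (by linarith) 4
  have hq' : 0 < q + ε := by linarith
  have hb' : 0 < b + ε := by linarith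
  have key := integral_condExp_sq_le_of_truncation hm₁ hm₂ (C := (q + ε) / (b + ε))
    (by positivity) (fun A B hA hB => (hα A B hA hB).trans hab) hf hf4 hmean
  have h1 : 8 * M / ((q + ε) / (b + ε)) ^ 2 ≤ 8 * ((q + ε) * (b + ε)) ^ 2 := by
    rw [div_le_iff₀ (by positivity)]
    calc 8 * M ≤ 8 * (q + ε) ^ 4 := by linarith
      _ = _ := by field_simp
  have h2 : 16 * ((q + ε) / (b + ε)) ^ 2 * (b + ε) ^ 4 = 16 * ((q + ε) * (b + ε)) ^ 2 := by
    field_simp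
  rw [Real.sqrt_le_left (by positivity)]
  nlinarith [sq_nonneg ((q + ε) * (b + ε))]

theorem sqrt_integral_condExp_sum_sq_le {Ω ι : Type*} {m m0 : MeasurableSpace Ω} {P : Measure Ω}
    [IsFiniteMeasure P] (s : Finset ι) {f : ι → Ω → ℝ} (hf : ∀ i ∈ s, MemLp (f i) 2 P) :
    √(∫ ω, (P[fun ω => ∑ i ∈ s, f i ω|m]) ω ^ 2 ∂P) ≤
      ∑ i ∈ s, √(∫ ω, (P[f i|m]) ω ^ 2 ∂P) := by
  have hnorm : ∀ g : Ω → ℝ, MemLp g 2 P → √(∫ ω, g ω ^ 2 ∂P) = lpNorm g 2 P := fun g hg => by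
    rw [lpNorm_eq_integral_norm_rpow_toReal two_ne_zero ENNReal.ofNat_ne_top
      hg.aestronglyMeasurable, Real.sqrt_eq_rpow]
    simp
  have hc : ∀ i ∈ s, MemLp (P[f i|m]) 2 P := fun i hi => (hf i hi).condExp one_le_two
  have hsum : P[fun ω => ∑ i ∈ s, f i ω|m] =ᵐ[P] ∑ i ∈ s, P[f i|m] := by
    rw [show (fun ω => ∑ i ∈ s, f i ω) = ∑ i ∈ s, f i by ext; simp]
    exact condExp_finsetSum (fun i hi => (hf i hi).integrable one_le_two) m
  rw [integral_congr_ae (g := fun ω => (∑ i ∈ s, P[f i|m]) ω ^ 2)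
      (hsum.mono fun ω hω => by simp only [hω]),
    hnorm _ (memLp_finsetSum' s hc), Finset.sum_congr rfl fun i hi => hnorm _ (hc i hi)]
  exact lpNorm_sum_le hc one_le_two

theorem abs_measureReal_inter_sub_le_one {Ω : Type*} {m0 : MeasurableSpace Ω} {P : Measure Ω}
    [IsProbabilityMeasure P] (A B : Set Ω) : |P.real (A ∩ B) - P.real A * P.real B| ≤ 1 := by
  have h1 : P.real (A ∩ B) ≤ 1 := measureReal_le_one
  have h2 : P.real A * P.real B ≤ 1 :=
    mul_le_one₀ measureReal_le_one measureReal_nonneg measureReal_le_one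
  have h3 : 0 ≤ P.real A * P.real B := by positivity
  have h4 : 0 ≤ P.real (A ∩ B) := measureReal_nonneg
  exact abs_le.mpr ⟨by linarith, by linarith⟩

theorem measurable_of_shift {Ω E : Type*} {m0 : MeasurableSpace Ω} [MeasurableSpace E] (T : Ω ≃ᵐ Ω)
    {X : ℤ → Ω → E} (hX : Measurable (X 0)) (hshift : ∀ k ω, X (k + 1) ω = X k (T ω)) (k : ℤ) :
    Measurable (X k) := by
  induction k using Int.induction_on with
  | zero => exact hX
  | succ k ih =>
    rw [show X (k + 1) = X k ∘ T from funext (hshift k)]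
    exact ih.comp T.measurable
  | pred k ih =>
    have hpred : X (-k - 1) = X (-k) ∘ T.symm := funext fun ω => by
      have h := hshift (-k - 1) (T.symm ω)
      rw [T.apply_symm_apply, sub_add_cancel] at h
      exact h.symm
    rw [hpred]
    exact ih.comp T.symm.measurable

theorem identDistrib_of_shift {Ω E : Type*} {m0 : MeasurableSpace Ω} [MeasurableSpace E]
    {P : Measure Ω} {T : Ω ≃ᵐ Ω} (hT : MeasurePreserving T P P) {X : ℤ → Ω → E}
    (hX : Measurable (X 0)) (hshift : ∀ k ω, X (k + 1) ω = X k (T ω)) (k : ℕ) :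
    ProbabilityTheory.IdentDistrib (X k) (X 0) P P := by
  have hm := measurable_of_shift T hX hshift
  induction k with
  | zero => exact .refl hX.aemeasurable
  | succ k ih =>
    refine .trans ⟨(hm _).aemeasurable, (hm k).aemeasurable, ?_⟩ ih
    rw [show X (k + 1 : ℕ) = X k ∘ T from funext fun ω => mod_cast hshift k ω,
      ← Measure.map_map (hm k) T.measurable, hT.map_eq]

theorem integral_pow_of_identDistrib {Ω : Type*} {m0 : MeasurableSpace Ω} {P : Measure Ω}
    {f g : Ω → ℝ} (h : ProbabilityTheory.IdentDistrib f g P P) (n : ℕ) :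
    ∫ ω, f ω ^ n ∂P = ∫ ω, g ω ^ n ∂P :=
  (h.comp (u := fun x : ℝ => x ^ n) (by fun_prop)).integral_eq

theorem integrable_pow_of_identDistrib {Ω : Type*} {m0 : MeasurableSpace Ω} {P : Measure Ω}
    {f g : Ω → ℝ} (h : ProbabilityTheory.IdentDistrib f g P P) {n : ℕ}
    (hg : Integrable (fun ω => g ω ^ n) P) : Integrable (fun ω => f ω ^ n) P :=
  (h.comp (u := fun x : ℝ => x ^ n) (by fun_prop)).integrable_iff.mpr hg

theorem memLp_two_of_identDistrib {Ω : Type*} {m0 : MeasurableSpace Ω} {P : Measure Ω}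
    {f g : Ω → ℝ} (h : ProbabilityTheory.IdentDistrib f g P P)
    (hg : Integrable (fun ω => g ω ^ 2) P) : MemLp f 2 P :=
  h.memLp_iff.mpr ((memLp_two_iff_integrable_sq h.aemeasurable_snd.aestronglyMeasurable).mpr hg)

/-- Under the stationary setup with `E[X₀⁴] < ∞`, for every `n ≥ 1`,
`‖E(Sₙ | F₀)‖ ≤ 8 ‖X₀‖₄ ∑_{k=1}^n α_k^{1/4}`. -/
theorem condexp_partial_sum_bound
    {Ω : Type*} [MeasurableSpace Ω] (P : Measure Ω) [IsProbabilityMeasure P]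
    (T : Ω ≃ᵐ Ω) (hT : MeasurePreserving T P P)
    (X : ℤ → Ω → ℝ) (hX0meas : Measurable (X 0))
    (hshift : ∀ k : ℤ, ∀ ω, X (k + 1) ω = X k (T ω))
    (hX2 : Integrable (fun ω => (X 0 ω) ^ 2) P)
    (hX4 : Integrable (fun ω => (X 0 ω) ^ 4) P)
    (hmean : ∫ ω, X 0 ω ∂P = 0)
    (S : ℕ → Ω → ℝ)
    (hS : ∀ n, S n = fun ω => ∑ i ∈ Finset.range n, X (i + 1) ω)
    (F0 : MeasurableSpace Ω)
    (hF0 : F0 = ⨆ k ∈ Set.Iic (0 : ℤ), MeasurableSpace.comap (X k) (borel ℝ))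
    (G : ℕ → MeasurableSpace Ω)
    (hG : ∀ n, G n = ⨆ k ∈ Set.Ici (n : ℤ), MeasurableSpace.comap (X k) (borel ℝ))
    (α : ℕ → ℝ)
    (hα : ∀ n, α n = sSup {x : ℝ | ∃ A B : Set Ω, MeasurableSet[F0] A ∧
        MeasurableSet[G n] B ∧
        x = |(P (A ∩ B)).toReal - (P A).toReal * (P B).toReal|}) :
    ∀ n : ℕ, 1 ≤ n →
      Real.sqrt (∫ ω, ((P[S n|F0]) ω) ^ 2 ∂P) ≤
        8 * (∫ ω, (X 0 ω) ^ 4 ∂P) ^ ((1 : ℝ) / 4) *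
          ∑ k ∈ Finset.Icc 1 n, (α k) ^ ((1 : ℝ) / 4) := by
  intro n _
  have hXmeas := measurable_of_shift T hX0meas hshift
  have hid := identDistrib_of_shift hT hX0meas hshift
  have hF0le : F0 ≤ _ := hF0.le.trans (iSup₂_le fun k _ => (hXmeas k).comap_le)
  have hGle : ∀ k, G k ≤ _ := fun k =>
    (hG k).le.trans (iSup₂_le fun j _ => (hXmeas j).comap_le)
  have hmix : ∀ k A B, MeasurableSet[F0] A → MeasurableSet[G k] B →
      |P.real (A ∩ B) - P.real A * P.real B| ≤ α k := fun k A B hA hB => by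
    rw [hα k]
    refine le_csSup ⟨1, ?_⟩ ⟨A, B, hA, hB, rfl⟩
    rintro _ ⟨A, B, -, -, rfl⟩
    exact abs_measureReal_inter_sub_le_one A B
  have hterm : ∀ k : ℕ, √(∫ ω, (P[X k|F0]) ω ^ 2 ∂P) ≤
      8 * (∫ ω, (X 0 ω) ^ 4 ∂P) ^ ((1 : ℝ) / 4) * (α k) ^ ((1 : ℝ) / 4) := fun k => by
    have hXG : Measurable[G k] (X k) := by
      refine Measurable.mono (comap_measurable (X k)) ?_ le_rfl
      rw [hG k]
      exact le_iSup₂_of_le (k : ℤ) Set.self_mem_Ici le_rfl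
    have h0 : 0 ≤ α k :=
      (abs_nonneg _).trans (hmix k ∅ ∅ (@MeasurableSet.empty _ F0) (@MeasurableSet.empty _ (G k)))
    rw [← integral_pow_of_identDistrib (hid k) 4]
    refine sqrt_integral_condExp_sq_le hF0le (hGle k) h0 (hmix k) hXG
      (integrable_pow_of_identDistrib (hid k) hX4) ?_
    simpa [hmean] using integral_pow_of_identDistrib (hid k) 1
  have hSn : S n = fun ω => ∑ k ∈ Finset.Icc 1 n, X (k : ℕ) ω := by
    rw [hS n]
    ext ω
    rw [← Finset.Ico_add_one_right_eq_Icc, Finset.sum_Ico_eq_sum_range]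
    simp [add_comm]
  rw [hSn, Finset.mul_sum]
  exact (sqrt_integral_condExp_sum_sq_le _ fun k _ => memLp_two_of_identDistrib (hid k) hX2).trans
    (Finset.sum_le_sum fun k _ => hterm k)
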